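/- arXiv:2206.01448 — 3 statements merged into one kernel-verified Lean document; each statement's English description precedes it below -/
import Mathlib

section
/- Let u, T : ℕ → ℝ², g : ℕ → ℝ², v_max > 0, δ ≥ 0, b ≥ 0. Set d(k) := −g(k) − (u(k) − T(k)), D(k) := ‖u(k) − T(k)‖, δ(k) := T(k+1) − T(k). Assume ‖δ(k)‖ ≤ δ, |g(k)₁| ≤ b, |g(k)₂| ≤ b, d(k) ≠ 0, and u(k+1) = u(k) + v_max·d(k)/‖d(k)‖. Then D(k+1)² − D(k)² ≤ v_max² − 2·v_max·‖d(k)‖ + δ² + 2√2·v_max·δ + 2√2·δ·D(k) + 4·v_max·b. -/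
open scoped RealInnerProductSpace

/-- A plane vector whose coordinates are bounded by `b` has Euclidean norm at most `2 * b`. -/
theorem EuclideanSpace.norm_le_two_mul_of_abs_le {x : EuclideanSpace ℝ (Fin 2)} {b : ℝ}
    (hb : 0 ≤ b) (h0 : |x 0| ≤ b) (h1 : |x 1| ≤ b) : ‖x‖ ≤ 2 * b := by
  rw [← sq_le_sq₀ (norm_nonneg x) (by positivity)]
  rw [EuclideanSpace.norm_sq_eq, Fin.sum_univ_two, Real.norm_eq_abs, Real.norm_eq_abs]
  nlinarith [abs_nonneg (x 0), abs_nonneg (x 1)]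

/-- The one-step descent estimate (equation (19) of the paper):
`D(k+1)² − D(k)² ≤ v_max² − 2 v_max ‖d(k)‖ + δ² + 2√2 v_max δ
 + 2√2 δ D(k) + 4 v_max b`. -/
theorem one_step_descent_estimate
    (u T g : ℕ → EuclideanSpace ℝ (Fin 2))
    (vmax δ b : ℝ) (hv : 0 < vmax) (hδ : 0 ≤ δ) (hb : 0 ≤ b)
    (d : ℕ → EuclideanSpace ℝ (Fin 2))
    (hd : ∀ k, d k = -g k - (u k - T k))
    (D : ℕ → ℝ) (hD : ∀ k, D k = ‖u k - T k‖)
    (dlt : ℕ → EuclideanSpace ℝ (Fin 2))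
    (hdlt : ∀ k, dlt k = T (k + 1) - T k)
    (k : ℕ)
    (hdltk : ‖dlt k‖ ≤ δ)
    (hg0 : |g k 0| ≤ b) (hg1 : |g k 1| ≤ b)
    (hne : d k ≠ 0)
    (hupd : u (k + 1) = u k + (vmax / ‖d k‖) • d k) :
    D (k + 1) ^ 2 - D k ^ 2
      ≤ vmax ^ 2 - 2 * vmax * ‖d k‖ + δ ^ 2 + 2 * Real.sqrt 2 * vmax * δ
        + 2 * Real.sqrt 2 * δ * D k + 4 * vmax * b := by
  have hpos : 0 < ‖d k‖ := norm_pos_iff.mpr hne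
  have hG := EuclideanSpace.norm_le_two_mul_of_abs_le hb hg0 hg1
  set s := (vmax / ‖d k‖) • d k with hs
  have hsn : ‖s‖ = vmax := by
    rw [hs, norm_smul, Real.norm_of_nonneg (by positivity)]
    field_simp
  have hds : ⟪d k, s⟫ = vmax * ‖d k‖ := by
    rw [hs, inner_smul_right, real_inner_self_eq_norm_sq]
    field_simp
  set w := u k - T k with hw
  have hws : ⟪w, s⟫ = -⟪g k, s⟫ - vmax * ‖d k‖ := by
    have hwgd : w = -g k - d k := by rw [hd k, hw]; abel
    rw [hwgd, inner_sub_left, inner_neg_left, hds]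
  have hstep : u (k + 1) - T (k + 1) = (w + s) - dlt k := by
    rw [hupd, hdlt k, hw]; abel
  have hgs : -⟪g k, s⟫ ≤ 2 * b * vmax := by
    have h := neg_le_of_abs_le (abs_real_inner_le_norm (g k) s)
    rw [hsn] at h
    nlinarith
  have hwd : -⟪w, dlt k⟫ ≤ ‖w‖ * δ := by
    have h := neg_le_of_abs_le (abs_real_inner_le_norm w (dlt k))
    nlinarith [mul_le_mul_of_nonneg_left hdltk (norm_nonneg w)]
  have hsd : -⟪s, dlt k⟫ ≤ vmax * δ := by
    have h := neg_le_of_abs_le (abs_real_inner_le_norm s (dlt k))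
    rw [hsn] at h
    nlinarith [mul_le_mul_of_nonneg_left hdltk hv.le]
  have hsq : ‖dlt k‖ ^ 2 ≤ δ ^ 2 := by gcongr
  have hsqrt : 1 ≤ Real.sqrt 2 := Real.one_le_sqrt.mpr (by norm_num)
  have hvδ : vmax * δ ≤ Real.sqrt 2 * (vmax * δ) :=
    le_mul_of_one_le_left (by positivity) hsqrt
  have hwδ : ‖w‖ * δ ≤ Real.sqrt 2 * (‖w‖ * δ) :=
    le_mul_of_one_le_left (by positivity) hsqrt
  rw [hD, hD, hstep, norm_sub_sq_real, norm_add_sq_real, inner_add_left, hsn, hws, ← hw]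
  linarith
end

section
/- Let v_max > 0 and δ ≥ 0 with v_max > √2·δ, and let b satisfy 0 < b < (v_max² − 2δ²)/(2√2·v_max); define ε := −[(1 − 2·√(1 − 2√2·b/v_max) − 2√2·δ/v_max)·v_max² + δ² + 2√2·v_max·δ + 4·v_max·b]. Let u, T : ℕ → ℝ², g : ℕ → ℝ², set d(k) := −g(k) − (u(k) − T(k)), D(k) := ‖u(k) − T(k)‖, δ(k) := T(k+1) − T(k). Fix k ∈ ℕ and assume ‖δ(k)‖ ≤ δ, |g(k)₁| ≤ b, |g(k)₂| ≤ b, D(k) > v_max, and u(k+1) = u(k) + v_max·d(k)/‖d(k)‖. Then D(k+1)² − D(k)² ≤ −ε. -/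
open scoped RealInnerProductSpace

/-- A vector of the plane whose coordinates are bounded by `b` has norm at most `√2 * b`. -/
lemma norm_le_sqrt_two_mul_of_abs_le {x : EuclideanSpace ℝ (Fin 2)} {b : ℝ}
    (h0 : |x 0| ≤ b) (h1 : |x 1| ≤ b) : ‖x‖ ≤ Real.sqrt 2 * b := by
  have hb : 0 ≤ b := (abs_nonneg _).trans h0
  refine abs_le_of_sq_le_sq' ?_ (by positivity) |>.2
  rw [EuclideanSpace.real_norm_sq_eq, Fin.sum_univ_two, mul_pow,
    Real.sq_sqrt (by norm_num : (0 : ℝ) ≤ 2)]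
  have := sq_le_sq' (abs_le.1 h0).1 (abs_le.1 h0).2
  have := sq_le_sq' (abs_le.1 h1).1 (abs_le.1 h1).2
  linarith

/-- If `e = -g - d` with `‖g‖ ≤ β` and `2 * β < ‖e‖`, the component `Y` of `e` against the
direction of `d` is positive, and `e` deviates from that direction by at most `β`. -/
lemma exists_component_of_perturbed_direction {E : Type*} [NormedAddCommGroup E]
    [InnerProductSpace ℝ E] {e g d : E} {β v : ℝ} (hd : d = -g - e) (hg : ‖g‖ ≤ β)
    (he : 2 * β < ‖e‖) :
    ∃ Y : ℝ, 0 < Y ∧ ‖e‖ ^ 2 - β ^ 2 ≤ Y ^ 2 ∧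
      ‖e + (v / ‖d‖) • d‖ ^ 2 = ‖e‖ ^ 2 + v ^ 2 - 2 * v * Y := by
  have hβ : 0 ≤ β := (norm_nonneg g).trans hg
  have hdn : ‖e‖ - β ≤ ‖d‖ := by
    have h : e = -(g + d) := by rw [hd]; abel
    have h2 : ‖e‖ ≤ ‖g‖ + ‖d‖ := by
      rw [h, norm_neg]; exact norm_add_le _ _
    linarith
  have hdpos : 0 < ‖d‖ := by linarith
  set n : E := ‖d‖⁻¹ • d with hn
  have hn1 : ‖n‖ = 1 := by
    rw [hn, norm_smul, norm_inv, norm_norm, inv_mul_cancel₀ hdpos.ne']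
  have hdn' : d = ‖d‖ • n := by rw [hn, smul_smul, mul_inv_cancel₀ hdpos.ne', one_smul]
  have hen : ⟪e, n⟫ = -(‖d‖ + ⟪g, n⟫) := by
    have h : e = -g - ‖d‖ • n := by rw [← hdn', hd]; abel
    rw [h, inner_sub_left, inner_neg_left, real_inner_smul_left,
      real_inner_self_eq_norm_sq, hn1]
    ring
  have hgn : |⟪g, n⟫| ≤ ‖g‖ := by
    simpa [hn1] using abs_real_inner_le_norm g n
  have hee : ‖e‖ ^ 2 = ‖g‖ ^ 2 + 2 * ‖d‖ * ⟪g, n⟫ + ‖d‖ ^ 2 := by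
    have h : e = -(g + ‖d‖ • n) := by rw [← hdn', hd]; abel
    rw [h, norm_neg, norm_add_sq_real, real_inner_smul_right, norm_smul, hn1, norm_norm]
    ring
  refine ⟨‖d‖ + ⟪g, n⟫, ?_, ?_, ?_⟩
  · linarith [(abs_le.1 hgn).1]
  · have := pow_le_pow_left₀ (norm_nonneg g) hg 2
    nlinarith [sq_nonneg ⟪g, n⟫]
  · have h : (v / ‖d‖) • d = v • n := by rw [hn, smul_smul, div_eq_mul_inv]
    rw [h, norm_add_sq_real, real_inner_smul_right, hen, norm_smul, hn1, mul_one,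
      Real.norm_eq_abs, sq_abs]
    ring

/-- The scalar inequality behind the one-step decrease. -/
lemma sq_add_sub_sq_le_of_component {v δ β D Y r w : ℝ} (hv : 0 < v)
    (hβ : 0 ≤ β) (hβv : 2 * β < v) (hδ : Real.sqrt 2 * δ < v) (hD : v < D)
    (hY : 0 < Y) (hY1 : D ^ 2 - β ^ 2 ≤ Y ^ 2)
    (hr : 0 ≤ r) (hr2 : r ^ 2 = D ^ 2 + v ^ 2 - 2 * v * Y)
    (hw2 : w ^ 2 = v ^ 2 - 2 * β * v) :
    (r + δ) ^ 2 - D ^ 2 ≤ v ^ 2 - 2 * v * w + δ ^ 2 + 2 * Real.sqrt 2 * β * v := by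
  have hq2 : Real.sqrt 2 ^ 2 = 2 := Real.sq_sqrt (by norm_num)
  have hq0 : 0 < Real.sqrt 2 := by positivity
  set q := Real.sqrt 2
  have hqlt : q < 2 := by nlinarith
  have hδ' : δ ≤ v * (q / 2) := by nlinarith
  have hrabs : r ≤ |Y - v| + β := by
    refine (abs_le_of_sq_le_sq' ?_ (by positivity)).2
    nlinarith [sq_abs (Y - v), mul_nonneg (abs_nonneg (Y - v)) hβ]
  have hvD : v ^ 2 < D ^ 2 := by nlinarith
  have key : r * (q / 2) - Y ≤ -w + q * β := by
    rcases le_total v Y with h | h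
    · rw [abs_of_nonneg (by linarith)] at hrabs
      have hwv : w ≤ v := by
        refine (abs_le_of_sq_le_sq' ?_ hv.le).2
        nlinarith [mul_nonneg hβ hv.le]
      nlinarith [mul_le_mul_of_nonneg_right hrabs hq0.le,
        mul_nonneg (sub_nonneg.2 h) (sub_nonneg.2 hqlt.le), mul_nonneg hq0.le hβ]
    · rw [abs_of_nonpos (by linarith)] at hrabs
      have hYv : v - β ≤ Y := by
        refine (abs_le_of_sq_le_sq' ?_ hY.le).2
        nlinarith
      have hwY : w ≤ Y := by
        refine (abs_le_of_sq_le_sq' ?_ hY.le).2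
        nlinarith
      have hrβ : r ≤ 2 * β := by linarith
      nlinarith [mul_le_mul_of_nonneg_right hrβ hq0.le]
  nlinarith [mul_le_mul_of_nonneg_left key hv.le, mul_le_mul_of_nonneg_left hδ' hr]

/-- The final one-step decrease estimate (equation (21) of the paper):
under the parameter conditions, while the agent is farther than `v_max`
from its target, the squared distance decreases by at least `ε`. -/
theorem one_step_decrease_by_epsilon
    (vmax δ b : ℝ)
    (hv : 0 < vmax) (hδ : 0 ≤ δ) (hvδ : Real.sqrt 2 * δ < vmax)
    (hb0 : 0 < b)
    (hb1 : b < (vmax ^ 2 - 2 * δ ^ 2) / (2 * Real.sqrt 2 * vmax))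
    (ε : ℝ)
    (hε : ε = -((1 - 2 * Real.sqrt (1 - 2 * Real.sqrt 2 * b / vmax)
          - 2 * Real.sqrt 2 * δ / vmax) * vmax ^ 2
        + δ ^ 2 + 2 * Real.sqrt 2 * vmax * δ + 4 * vmax * b))
    (u T g : ℕ → EuclideanSpace ℝ (Fin 2))
    (d : ℕ → EuclideanSpace ℝ (Fin 2))
    (hd : ∀ k, d k = -g k - (u k - T k))
    (D : ℕ → ℝ) (hD : ∀ k, D k = ‖u k - T k‖)
    (dlt : ℕ → EuclideanSpace ℝ (Fin 2))
    (hdlt : ∀ k, dlt k = T (k + 1) - T k)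
    (k : ℕ)
    (hdltk : ‖dlt k‖ ≤ δ)
    (hg0 : |g k 0| ≤ b) (hg1 : |g k 1| ≤ b)
    (hDk : vmax < D k)
    (hupd : u (k + 1) = u k + (vmax / ‖d k‖) • d k) :
    D (k + 1) ^ 2 - D k ^ 2 ≤ -ε := by
  have hq2 : Real.sqrt 2 * Real.sqrt 2 = 2 := Real.mul_self_sqrt (by norm_num)
  have hq0 : 0 < Real.sqrt 2 := by positivity
  have hg := norm_le_sqrt_two_mul_of_abs_le hg0 hg1
  have hβ : 0 ≤ Real.sqrt 2 * b := by positivity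
  have hβv : 2 * (Real.sqrt 2 * b) < vmax := by
    rw [lt_div_iff₀ (by positivity)] at hb1
    refine lt_of_mul_lt_mul_right ?_ hv.le
    nlinarith [sq_nonneg δ]
  rw [hD k] at hDk
  obtain ⟨Y, hY, hY1, hr2⟩ :=
    exists_component_of_perturbed_direction (v := vmax) (hd k) hg (hβv.trans hDk)
  have hw2 : (vmax * Real.sqrt (1 - 2 * Real.sqrt 2 * b / vmax)) ^ 2
      = vmax ^ 2 - 2 * (Real.sqrt 2 * b) * vmax := by
    rw [mul_pow, Real.sq_sqrt]
    · field_simp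
    · rw [sub_nonneg, div_le_one hv]; linarith
  have hmain := sq_add_sub_sq_le_of_component hv hβ hβv hvδ hDk hY hY1
    (norm_nonneg _) hr2 hw2
  have hstep : D (k + 1) ≤ ‖u k - T k + (vmax / ‖d k‖) • d k‖ + δ := by
    have h : u (k + 1) - T (k + 1) = (u k - T k + (vmax / ‖d k‖) • d k) - dlt k := by
      rw [hupd, hdlt]; abel
    rw [hD, h]
    exact (norm_sub_le _ _).trans (by gcongr)
  have hsq := pow_le_pow_left₀ (by rw [hD]; exact norm_nonneg _) hstep 2
  have hcancel : 2 * Real.sqrt 2 * δ / vmax * vmax ^ 2 = 2 * Real.sqrt 2 * vmax * δ := by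
    field_simp
  have hb2 : 2 * Real.sqrt 2 * (Real.sqrt 2 * b) * vmax = 4 * vmax * b := by
    linear_combination 2 * b * vmax * hq2
  rw [hε, neg_neg, hD k]
  linarith
end

section
/- Let n ≥ 1, let w : Fin n × Fin n → ℝ be a weight function on a complete bipartite graph with parts of size n, and let lR, lP : Fin n → ℝ be a feasible labeling, i.e., lR(i) + lP(j) ≥ w(i, j) for all i, j. Suppose π is a permutation of Fin n such that lR(i) + lP(π(i)) = w(i, π(i)) for all i (i.e., π is a perfect matching contained in the equality subgraph of the labeling). Then π is a maximum weighted perfect matching: for every permutation σ of Fin n, Σ_{i} w(i, π(i)) ≥ Σ_{i} w(i, σ(i)). -/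
/-- The Kuhn–Munkres theorem: if `(lR, lP)` is a feasible vertex labeling of
the weighted complete bipartite graph on two copies of `Fin n` and the
permutation `π` is a perfect matching contained in the equality subgraph of
the labeling, then `π` is a maximum weighted perfect matching. -/
theorem kuhn_munkres
    (n : ℕ) (hn : 1 ≤ n)
    (w : Fin n × Fin n → ℝ)
    (lR lP : Fin n → ℝ)
    (hfeasible : ∀ i j : Fin n, w (i, j) ≤ lR i + lP j)
    (π : Equiv.Perm (Fin n))
    (hequality : ∀ i : Fin n, lR i + lP (π i) = w (i, π i)) :
    ∀ σ : Equiv.Perm (Fin n),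
      ∑ i : Fin n, w (i, σ i) ≤ ∑ i : Fin n, w (i, π i) := by
  intro σ
  calc ∑ i, w (i, σ i) ≤ ∑ i, (lR i + lP (σ i)) :=
        Finset.sum_le_sum fun i _ => hfeasible i (σ i)
    _ = ∑ i, (lR i + lP (π i)) := by
        simp only [Finset.sum_add_distrib, Equiv.sum_comp]
    _ = ∑ i, w (i, π i) := Finset.sum_congr rfl fun i _ => hequality i
end
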